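/- Let B be standard Brownian motion, Z_i = Σ_{k=1}^i B_k/k, fix α ∈ [0,1/2), and suppose times s_1,...,s_M ∈ [0,N] satisfy Σ_{j=1}^M |Corr(Z_{s_i}, Z_{s_j})| ≤ 5/4 for each i and (E Z_{s_i}^2)^{1/2} ≥ N^α/2 for each i. Then P(max_{k ≤ N} Z_k ≤ N^α) ≤ e^{-M/10}. -/

import Mathlib

open MeasureTheory ProbabilityTheory Real Finset

/-- A family of real random variables is a (centered or not) Gaussian family if every finite
linear combination of its members has a Gaussian distribution. -/
def IsGaussianFamily {Ω : Type*} [MeasurableSpace Ω] {ι : Type*}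
    (B : ι → Ω → ℝ) (μ : Measure Ω) : Prop :=
  ∀ (n : ℕ) (t : Fin n → ι) (c : Fin n → ℝ), ∃ (m : ℝ) (v : NNReal),
    Measure.map (fun ω => ∑ i, c i * B (t i) ω) μ = gaussianReal m v

/-- A standard Brownian motion (as far as its finite-dimensional distributions are concerned). -/
def IsStandardBrownianMotion {Ω : Type*} [MeasurableSpace Ω]
    (B : ℝ → Ω → ℝ) (μ : Measure Ω) : Prop :=
  IsProbabilityMeasure μ ∧ (∀ t, Measurable (B t)) ∧ (∀ ω, B 0 ω = 0) ∧
    IsGaussianFamily B μ ∧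
    (∀ t : ℝ, 0 ≤ t → ∫ ω, B t ω ∂μ = 0) ∧
    (∀ s t : ℝ, 0 ≤ s → 0 ≤ t → ∫ ω, B s ω * B t ω ∂μ = min s t)

/-- The covariance of two real random variables. -/
noncomputable def cov {Ω : Type*} [MeasurableSpace Ω] (X Y : Ω → ℝ) (μ : Measure Ω) : ℝ :=
  ∫ ω, X ω * Y ω ∂μ - (∫ ω, X ω ∂μ) * (∫ ω, Y ω ∂μ)

/-- The correlation of two real random variables. -/
noncomputable def corr {Ω : Type*} [MeasurableSpace Ω] (X Y : Ω → ℝ) (μ : Measure Ω) : ℝ :=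
  cov X Y μ / (Real.sqrt (∫ ω, X ω ^ 2 ∂μ) * Real.sqrt (∫ ω, Y ω ^ 2 ∂μ))

lemma gauss_half (v : NNReal) (hv : v ≠ 0) : gaussianReal 0 v (Set.Iic 0) = ENNReal.ofReal (1/2) := by
  have := nullSingletonClass_gaussianReal (μ := 0) hv
  have h1 : gaussianReal 0 v (Set.Iic 0) = gaussianReal 0 v (Set.Ioi 0) := by
    conv_lhs => rw [← neg_zero, ← gaussianReal_map_neg, neg_zero]
    rw [Measure.map_apply (by fun_prop) measurableSet_Iic]
    have : (fun x : ℝ => -x) ⁻¹' Set.Iic 0 = Set.Ici 0 := by ext; simp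
    rw [this]
    exact (measure_congr Ioi_ae_eq_Ici).symm
  have h2 := measure_add_measure_compl (μ := gaussianReal 0 v) (measurableSet_Iic (a := (0:ℝ)))
  rw [Set.compl_Iic, ← h1, measure_univ, ← two_mul] at h2
  rw [one_div, ENNReal.ofReal_inv_of_pos (by norm_num)]
  apply ENNReal.eq_inv_of_mul_eq_one_left
  rw [mul_comm]; simpa using h2

lemma gauss_pos (v : NNReal) (hv : v ≠ 0) (a : ℝ) (ha : 0 ≤ a) :
    gaussianReal 0 v (Set.Iic a) ≤ ENNReal.ofReal (1/2 + a / √(2 * π * v)) := by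
  rw [← Set.Iic_union_Ioc_eq_Iic ha]
  refine (measure_union_le _ _).trans ?_
  rw [gauss_half v hv, ENNReal.ofReal_add (by norm_num) (by positivity)]
  gcongr
  rw [gaussianReal_apply _ hv]
  calc ∫⁻ x in Set.Ioc 0 a, gaussianPDF 0 v x ≤ ∫⁻ x in Set.Ioc 0 a, ENNReal.ofReal ((√(2 * π * v))⁻¹) := by
        apply lintegral_mono
        intro x
        unfold gaussianPDF gaussianPDFReal
        apply ENNReal.ofReal_le_ofReal
        apply mul_le_of_le_one_right (by positivity)
        rw [Real.exp_le_one_iff]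
        apply div_nonpos_of_nonpos_of_nonneg
        · nlinarith [sq_nonneg (x-0)]
        · positivity
    _ = _ := by
        rw [setLIntegral_const, Real.volume_Ioc, sub_zero, ← ENNReal.ofReal_mul (by positivity)]
        congr 1; field_simp

lemma gauss_neg (v : NNReal) (hv : v ≠ 0) (a : ℝ) (ha : a ≤ 0) :
    gaussianReal 0 v (Set.Iic a) ≤ ENNReal.ofReal (1/2 * Real.exp (- a^2 / (2 * v))) := by
  have h1 : gaussianReal 0 v (Set.Iic a) = gaussianReal (0 - a) v (Set.Iic 0) := by
    rw [← gaussianReal_map_sub_const, Measure.map_apply (by fun_prop) measurableSet_Iic]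
    congr 1; ext; simp
  rw [h1, mul_comm, ENNReal.ofReal_mul (by positivity), ← gauss_half v hv, gaussianReal_apply _ hv,
    gaussianReal_apply _ hv, ← lintegral_const_mul _ (by fun_prop)]
  apply setLIntegral_mono (by fun_prop)
  intro x hx
  have hx : x ≤ 0 := hx
  unfold gaussianPDF gaussianPDFReal
  rw [← ENNReal.ofReal_mul (by positivity)]
  apply ENNReal.ofReal_le_ofReal
  rw [mul_left_comm, ← Real.exp_add]
  gcongr
  rw [← add_div]
  gcongr
  nlinarith [mul_nonneg_of_nonpos_of_nonpos hx ha]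

lemma gauss_exp (a : ℝ) :
    gaussianReal 0 (3/4) (Set.Iic a) ≤ ENNReal.ofReal (0.59 * Real.exp (a/2)) := by
  have h34 : (3/4 : NNReal) ≠ 0 := by norm_num
  rcases le_total 0 a with ha | ha
  · refine (gauss_pos _ h34 a ha).trans (ENNReal.ofReal_le_ofReal ?_)
    have hs : (2.1664:ℝ) ≤ √(2 * π * (3/4 : NNReal)) := by
      apply Real.le_sqrt_of_sq_le
      have := Real.pi_gt_d4
      push_cast
      nlinarith
    have h1 : a / √(2 * π * (3/4 : NNReal)) ≤ a / 2.1664 := by gcongr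
    have h2 : (1.565:ℝ) ≤ Real.exp 0.45 := by
      have := Real.sum_le_exp_of_nonneg (x := 0.45) (by norm_num) 4
      refine le_trans ?_ this
      norm_num [Finset.sum_range_succ, Nat.factorial]
    have h3 : Real.exp (a/2) = Real.exp 0.45 * Real.exp (a/2 - 0.45) := by
      rw [← Real.exp_add]; ring_nf
    have h4 := Real.add_one_le_exp (a/2 - 0.45)
    have h5 : Real.exp 0.45 * (a/2 - 0.45 + 1) ≤ Real.exp (a/2) := by
      rw [h3]; gcongr
    have h6 : 1.565 * (a/2 - 0.45 + 1) ≤ Real.exp 0.45 * (a/2 - 0.45 + 1) := by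
      apply mul_le_mul_of_nonneg_right h2; linarith
    have h7 : a / 2.1664 ≤ 0.4616 * a := by
      rw [div_le_iff₀ (by norm_num)]; nlinarith
    linarith
  · refine (gauss_neg _ h34 a ha).trans (ENNReal.ofReal_le_ofReal ?_)
    have h1 : Real.exp (-a^2/(2 * (3/4 : NNReal))) ≤ Real.exp (a/2 + 3/32) := by
      apply Real.exp_le_exp.2
      push_cast
      rw [div_le_iff₀ (by norm_num)]
      nlinarith [sq_nonneg (a + 3/8)]
    have h2 : Real.exp (3/32) ≤ 1.18 := by
      have := Real.exp_bound_div_one_sub_of_interval (x := 3/32) (by norm_num) (by norm_num)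
      refine this.trans (by norm_num)
    rw [Real.exp_add] at h1
    nlinarith [Real.exp_pos (a/2)]

lemma quad_lower {ι : Type*} [Fintype ι] [DecidableEq ι] (R : Matrix ι ι ℝ)
    (hsymm : ∀ i j, R i j = R j i) (hdiag : ∀ i, R i i = 1)
    (hrow : ∀ i, ∑ j, |R i j| ≤ 5/4) (x : ι → ℝ) :
    3/4 * ∑ i, x i ^ 2 ≤ ∑ i, ∑ j, x i * (R i j * x j) := by
  have h1 : ∑ i, 2 * x i ^ 2 ≤
      ∑ i, ∑ j, (x i * (R i j * x j) + |R i j| * (x i ^ 2 / 2 + x j ^ 2 / 2)) := by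
    apply Finset.sum_le_sum
    intro i _
    refine le_trans ?_ (Finset.single_le_sum (f := fun j => x i * (R i j * x j) +
      |R i j| * (x i ^ 2 / 2 + x j ^ 2 / 2)) ?_ (Finset.mem_univ i))
    · simp only [hdiag, abs_one]; apply le_of_eq; ring
    · intro j _
      have e1 : -(|R i j| * |x i * x j|) ≤ R i j * (x i * x j) := by
        rw [← abs_mul]; exact neg_abs_le _
      have e2 : |x i * x j| ≤ x i ^ 2 / 2 + x j ^ 2 / 2 := by
        rw [abs_le]; constructor <;> nlinarith [sq_nonneg (x i + x j), sq_nonneg (x i - x j)]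
      nlinarith [mul_le_mul_of_nonneg_left e2 (abs_nonneg (R i j))]
  have h2 : ∑ i, ∑ j, |R i j| * (x i ^ 2 / 2 + x j ^ 2 / 2) = ∑ i, (∑ j, |R i j|) * x i ^ 2 := by
    have : ∑ i, ∑ j, |R i j| * (x j ^ 2 / 2) = ∑ i, ∑ j, |R i j| * (x i ^ 2 / 2) := by
      rw [Finset.sum_comm]
      refine Finset.sum_congr rfl fun i _ => Finset.sum_congr rfl fun j _ => ?_
      rw [hsymm]
    simp_rw [mul_add, Finset.sum_add_distrib, this, ← Finset.sum_mul]
    rw [← Finset.sum_add_distrib]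
    apply Finset.sum_congr rfl; intros; ring
  have h3 : ∑ i, (∑ j, |R i j|) * x i ^ 2 ≤ ∑ i, 5/4 * x i ^ 2 :=
    Finset.sum_le_sum fun i _ => mul_le_mul_of_nonneg_right (hrow i) (sq_nonneg _)
  simp_rw [Finset.sum_add_distrib] at h1
  rw [h2] at h1
  rw [← Finset.mul_sum] at h1 h3
  linarith

lemma core {Ω ι : Type*} [MeasurableSpace Ω] (P : Measure Ω) [IsProbabilityMeasure P]
    [Fintype ι] [DecidableEq ι] (X : ι → Ω → ℝ) (hX : ∀ i, Measurable (X i)) (R : Matrix ι ι ℝ)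
    (hsymm : ∀ i j, R i j = R j i) (hdiag : ∀ i, R i i = 1)
    (hrow : ∀ i, ∑ j, |R i j| ≤ 5/4)
    (hlaw : ∀ x : ι → ℝ, P.map (fun ω => ∑ i, x i * X i ω) =
      gaussianReal 0 (∑ i, ∑ j, x i * (R i j * x j)).toNNReal) :
    P {ω | ∀ i, X i ω ≤ 1/2} ≤ ENNReal.ofReal (Real.exp (-1/5)) ^ Fintype.card ι := by
  set S : Matrix ι ι ℝ := R - (3/4 : ℝ) • (1 : Matrix ι ι ℝ) with hS
  have hquad : ∀ x : ι → ℝ, x ⬝ᵥ S.mulVec x =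
      ∑ i, ∑ j, x i * (R i j * x j) - 3/4 * ∑ i, x i ^ 2 := by
    intro x
    rw [hS, Matrix.sub_mulVec, dotProduct_sub, Matrix.smul_mulVec, Matrix.one_mulVec,
      dotProduct_smul]
    simp only [dotProduct, Matrix.mulVec, Finset.mul_sum, smul_eq_mul, pow_two]
  have hpsd : S.PosSemidef := by
    apply Matrix.PosSemidef.of_dotProduct_mulVec_nonneg
    · ext i j
      simp [hS, hsymm i j, Matrix.one_apply, eq_comm]
    · intro x
      rw [star_trivial, hquad]
      linarith [quad_lower R hsymm hdiag hrow x]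
  set μ1 : Measure (EuclideanSpace ℝ ι) :=
    (Measure.pi (fun _ : ι => gaussianReal 0 (3/4))).map (WithLp.toLp 2) with hμ1
  set μ2 : Measure (EuclideanSpace ℝ ι) := multivariateGaussian 0 S with hμ2
  have hm1 : IsProbabilityMeasure μ1 := Measure.isProbabilityMeasure_map (by fun_prop)
  set T : Ω → EuclideanSpace ℝ ι := fun ω => WithLp.toLp 2 (fun i => X i ω) with hT
  have hTm : Measurable T := by fun_prop
  have hPT : IsProbabilityMeasure (P.map T) := Measure.isProbabilityMeasure_map hTm.aemeasurable
  have hconv : P.map T = μ1 ∗ μ2 := by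
    apply Measure.ext_of_charFun
    ext x
    rw [charFun_conv, hμ1, charFun_pi, hμ2, charFun_multivariateGaussian hpsd]
    have e1 : charFun (P.map T) x = charFun (P.map (fun ω => ∑ i, x i * X i ω)) 1 := by
      rw [charFun_apply, charFun_apply, integral_map hTm.aemeasurable (by fun_prop),
        integral_map (by fun_prop) (by fun_prop)]
      congr 1; ext ω
      simp [hT, PiLp.inner_apply]
    rw [e1, hlaw]
    simp_rw [charFun_gaussianReal]
    rw [← Complex.exp_sum, ← Complex.exp_add, hquad]
    have hnn : 0 ≤ ∑ i, ∑ j, x i * (R i j * x j) :=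
      le_trans (by positivity) (quad_lower R hsymm hdiag hrow x)
    rw [Real.coe_toNNReal _ hnn]
    have e2 : ∑ i, ((x i : ℂ) * ((0:ℝ):ℂ) * Complex.I - (((3/4 : NNReal) : ℝ) : ℂ) * (x i : ℂ)^2 / 2)
        = -(((3/4 * ∑ i, x i ^ 2 : ℝ)) : ℂ) / 2 := by
      push_cast
      simp only [mul_zero, zero_mul, zero_sub, Finset.sum_neg_distrib, Finset.mul_sum,
        Finset.sum_div, neg_div]
    rw [e2]
    generalize ∑ i, ∑ j, x i * (R i j * x j) = q
    congr 1
    simp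
    ring
  have hA : MeasurableSet {y : EuclideanSpace ℝ ι | ∀ i, y i ≤ 1/2} := by
    rw [Set.ofPred_forall]
    exact MeasurableSet.iInter fun i => measurableSet_le (by fun_prop) (by fun_prop)
  have h1 : P {ω | ∀ i, X i ω ≤ 1/2} = (μ1 ∗ μ2) {y | ∀ i, y i ≤ 1/2} := by
    rw [← hconv, Measure.map_apply hTm hA]; rfl
  have hsl : ∀ y : EuclideanSpace ℝ ι, μ1 {x | ∀ i, x i + y i ≤ 1/2} ≤
      ENNReal.ofReal ((0.59 * Real.exp (1/4)) ^ Fintype.card ι) *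
        ENNReal.ofReal (Real.exp (-1/2 * ∑ i, y i)) := by
    intro y
    have hA' : MeasurableSet {x : EuclideanSpace ℝ ι | ∀ i, x i + y i ≤ 1/2} := by
      rw [Set.ofPred_forall]
      exact MeasurableSet.iInter fun i => measurableSet_le (by fun_prop) (by fun_prop)
    rw [hμ1, Measure.map_apply (by fun_prop) hA']
    have : (WithLp.toLp 2 ⁻¹' {x : EuclideanSpace ℝ ι | ∀ i, x i + y i ≤ 1/2}) =
        Set.univ.pi (fun i => Set.Iic (1/2 - y i)) := by
      ext x; simp [Pi.le_def, le_sub_iff_add_le]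
    rw [this, Measure.pi_pi]
    refine (Finset.prod_le_prod' fun i _ => gauss_exp _).trans ?_
    rw [← ENNReal.ofReal_prod_of_nonneg (fun i _ => by positivity), ← ENNReal.ofReal_mul (by positivity)]
    apply ENNReal.ofReal_le_ofReal
    apply le_of_eq
    have : ∀ i, 0.59 * Real.exp ((1/2 - y i)/2) = (0.59 * Real.exp (1/4)) * Real.exp (-1/2 * y i) := by
      intro i
      rw [mul_assoc, ← Real.exp_add]; ring_nf
    simp_rw [this]
    rw [Finset.prod_mul_distrib, ← Real.exp_sum, Finset.mul_sum]
    simp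
  have hexp : ∫⁻ y, ENNReal.ofReal (Real.exp (-1/2 * ∑ i, y i)) ∂μ2 ≤
      ENNReal.ofReal (Real.exp (1/16) ^ Fintype.card ι) := by
    set o : EuclideanSpace ℝ ι := WithLp.toLp 2 (fun _ => 1) with ho
    have hin : ∀ y : EuclideanSpace ℝ ι, innerSL ℝ o y = ∑ i, y i := by
      intro y; simp [ho, PiLp.inner_apply]
    have hmap := IsGaussian.map_eq_gaussianReal (μ := μ2) (innerSL ℝ o)
    have hmean : ∫ y, innerSL ℝ o y ∂μ2 = 0 := by
      rw [ContinuousLinearMap.integral_comp_id_comm IsGaussian.integrable_id]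
      rw [hμ2, integral_id_multivariateGaussian, map_zero]
    have hvar : Var[innerSL ℝ o; μ2] = o.ofLp ⬝ᵥ S.mulVec o.ofLp := by
      rw [← covarianceBilin_multivariateGaussian (μ := 0) hpsd, covarianceBilin_self IsGaussian.memLp_two_id]
      rfl
    rw [hmean] at hmap
    have hmgf := mgf_gaussianReal hmap (-1/2)
    have hIntegrable : Integrable (fun y => Real.exp (-1/2 * innerSL ℝ o y)) μ2 := by
      have := integrable_exp_mul_gaussianReal (μ := 0) (v := Var[innerSL ℝ o; μ2].toNNReal) (-1/2)
      rw [← hmap] at this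
      exact this.comp_measurable (by fun_prop)
    simp_rw [← hin]
    rw [← ofReal_integral_eq_lintegral_ofReal hIntegrable (ae_of_all _ fun _ => by positivity)]
    apply ENNReal.ofReal_le_ofReal
    rw [mgf] at hmgf
    rw [hmgf, ← Real.exp_nat_mul, Real.exp_le_exp, Real.coe_toNNReal _ (variance_nonneg _ _), hvar, hquad]
    have : ∑ i, ∑ j, o i * (R i j * o j) ≤ ∑ i : ι, (5/4 : ℝ) := by
      apply Finset.sum_le_sum
      intro i _
      refine le_trans (Finset.sum_le_sum fun j _ => ?_) (hrow i)
      simpa [ho] using le_abs_self (R i j)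
    have h2 : ∑ i, o i ^ 2 = (Fintype.card ι : ℝ) := by simp [ho]
    rw [h2]
    simp at this
    linarith
  rw [h1, Measure.conv, Measure.map_apply (by fun_prop) hA,
    Measure.prod_apply_symm (measurable_add hA)]
  refine (lintegral_mono (g := fun y => _) hsl).trans ?_
  rw [lintegral_const_mul _ (by fun_prop)]
  refine (mul_le_mul_right hexp _).trans ?_
  rw [← ENNReal.ofReal_mul (by positivity), ← mul_pow, ← ENNReal.ofReal_pow (by positivity)]
  apply ENNReal.ofReal_le_ofReal
  apply pow_le_pow_left₀ (by positivity)
  rw [mul_assoc, ← Real.exp_add]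
  have h3 : (0.59 : ℝ) * Real.exp (41/80) ≤ 1 := by
    have e1 : Real.exp 1 < 2.7182818286 := Real.exp_one_lt_d9
    have e2 : Real.exp (41/80) = Real.exp (1/2) * Real.exp (1/80) := by
      rw [← Real.exp_add]; norm_num
    have e3 : Real.exp (1/2) ≤ 1.6488 := by
      apply le_of_pow_le_pow_left₀ (n := 2) (by norm_num) (by norm_num)
      rw [← Real.exp_nat_mul]; norm_num at e1 ⊢; linarith
    have e4 : Real.exp (1/80) ≤ 80/79 := by
      have := Real.exp_bound_div_one_sub_of_interval (x := 1/80) (by norm_num) (by norm_num)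
      refine this.trans (by norm_num)
    rw [e2]
    have := mul_le_mul e3 e4 (by positivity) (by norm_num)
    linarith
  have h4 : (0.59 : ℝ) * Real.exp (1/4 + 1/16) = 0.59 * Real.exp (41/80) * Real.exp (-1/5) := by
    rw [mul_assoc, ← Real.exp_add]; norm_num
  rw [h4]
  nlinarith [Real.exp_pos (-1/5)]

lemma law_of_centered {Ω : Type*} [MeasurableSpace Ω] (P : Measure Ω) [IsProbabilityMeasure P]
    (Y : Ω → ℝ) (hY : Measurable Y) (h : ∃ (m : ℝ) (v : NNReal), P.map Y = gaussianReal m v)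
    (h0 : ∫ ω, Y ω ∂P = 0) : P.map Y = gaussianReal 0 (∫ ω, Y ω ^ 2 ∂P).toNNReal := by
  obtain ⟨m, v, hmv⟩ := h
  have e1 : ∫ ω, Y ω ∂P = m := by
    have : ∫ y, y ∂(P.map Y) = ∫ ω, Y ω ∂P := integral_map hY.aemeasurable (by fun_prop)
    rw [← this, hmv, integral_id_gaussianReal]
  have hm : m = 0 := by rw [← e1, h0]
  subst hm
  have e2 : ∫ ω, Y ω ^ 2 ∂P = v := by
    have h2 : Var[fun y => y; P.map Y] = v := by rw [hmv, variance_fun_id_gaussianReal]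
    rw [variance_eq_integral (by fun_prop), integral_map hY.aemeasurable (by fun_prop), integral_map hY.aemeasurable (by fun_prop), h0] at h2
    simpa using h2
  rw [e2, hmv, Real.toNNReal_coe]

lemma memLp_of_gauss {Ω : Type*} [MeasurableSpace Ω] (P : Measure Ω)
    (Y : Ω → ℝ) (hY : Measurable Y) (h : ∃ (m : ℝ) (v : NNReal), P.map Y = gaussianReal m v) :
    MemLp Y 2 P := by
  obtain ⟨m, v, hmv⟩ := h
  have : MemLp id 2 (P.map Y) := by rw [hmv]; exact memLp_id_gaussianReal 2
  exact (memLp_map_measure_iff (by fun_prop) hY.aemeasurable).1 this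

theorem li_shao_instance {Ω : Type*} [MeasureSpace Ω]
    (B : ℝ → Ω → ℝ) (hB : IsStandardBrownianMotion B (ℙ : Measure Ω))
    (Z : ℕ → Ω → ℝ) (hZ : ∀ n ω, Z n ω = ∑ k ∈ Finset.Icc 1 n, B k ω / k)
    (α : ℝ) (hα : α ∈ Set.Ico (0 : ℝ) (1 / 2))
    (N : ℕ) (hN : 1 ≤ N) (M : ℕ) (s : Fin M → ℕ) (hs : ∀ i, s i ≤ N)
    (hcorr : ∀ i : Fin M, ∑ j : Fin M, |corr (Z (s i)) (Z (s j)) ℙ| ≤ 5 / 4)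
    (hsd : ∀ i : Fin M, (N : ℝ) ^ α / 2 ≤ Real.sqrt (∫ ω, Z (s i) ω ^ 2 ∂ℙ)) :
    ℙ {ω | ∀ k ≤ N, Z k ω ≤ (N : ℝ) ^ α} ≤ ENNReal.ofReal (Real.exp (-(M : ℝ) / 10)) := by

  obtain ⟨hP, hBm, hB0, hG, hmean, hcov⟩ := hB
  have hBL : ∀ t, MemLp (B t) 2 ℙ := by
    intro t
    apply memLp_of_gauss _ _ (hBm t)
    obtain ⟨m, v, h⟩ := hG 1 (fun _ => t) (fun _ => 1)
    exact ⟨m, v, by simpa using h⟩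
  have hZfun : ∀ n, Z n = fun ω => ∑ k ∈ Finset.Icc 1 n, B k ω / k := fun n => funext (hZ n)
  have hZm : ∀ n, Measurable (Z n) := by
    intro n; rw [hZfun]; fun_prop
  have hZL : ∀ n, MemLp (Z n) 2 ℙ := by
    intro n; rw [hZfun]
    apply memLp_finsetSum
    intro k _
    simpa [div_eq_inv_mul] using (hBL k).const_mul ((k:ℝ)⁻¹)
  have hZmean : ∀ n, ∫ ω, Z n ω ∂ℙ = 0 := by
    intro n
    simp_rw [hZ]
    rw [integral_finsetSum _ (fun (k : ℕ) _ => ((hBL (k : ℝ)).integrable (by norm_num)).div_const _)]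
    apply Finset.sum_eq_zero
    intro k _
    rw [integral_div, hmean _ (by positivity), zero_div]
  have hZcov : ∀ m n, ∫ ω, Z m ω * Z n ω ∂ℙ =
      ∑ j ∈ Finset.Icc 1 m, ∑ k ∈ Finset.Icc 1 n, min (j:ℝ) k / (j * k) := by
    intro m n
    simp_rw [hZ, Finset.sum_mul_sum]
    have hi : ∀ j k : ℕ, Integrable (fun ω => B j ω / j * (B k ω / k)) ℙ := by
      intro j k
      have := ((hBL j).integrable_mul (hBL k)).div_const ((j:ℝ) * k)
      refine this.congr (ae_of_all _ fun ω => ?_)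
      simp only [Pi.mul_apply]
      rw [div_mul_div_comm]
    rw [integral_finsetSum _ (fun j _ => integrable_finsetSum _ fun k _ => hi j k)]
    refine Finset.sum_congr rfl fun j _ => ?_
    rw [integral_finsetSum _ (fun k _ => hi j k)]
    refine Finset.sum_congr rfl fun k _ => ?_
    simp_rw [div_mul_div_comm]
    rw [integral_div, hcov _ _ (by positivity) (by positivity)]
  have hZmono : ∀ m n, m ≤ n → ∫ ω, Z m ω ^ 2 ∂ℙ ≤ ∫ ω, Z m ω * Z n ω ∂ℙ := by
    intro m n hmn
    simp_rw [pow_two]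
    rw [hZcov, hZcov]
    refine Finset.sum_le_sum fun j _ => ?_
    apply Finset.sum_le_sum_of_subset_of_nonneg (Finset.Icc_subset_Icc_right hmn)
    intro k _ _
    positivity
  have hVN : (N : ℝ) ≤ ∫ ω, Z N ω ^ 2 ∂ℙ := by
    simp_rw [pow_two]
    rw [hZcov]
    have hN0 : (0:ℝ) < N := by exact_mod_cast hN
    calc (N:ℝ) = ∑ j ∈ Finset.Icc 1 N, ∑ k ∈ Finset.Icc 1 N, (1 / N : ℝ) := by
          simp; field_simp
      _ ≤ _ := by
          refine Finset.sum_le_sum fun j hj => Finset.sum_le_sum fun k hk => ?_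
          rw [Finset.mem_Icc] at hj hk
          have hj0 : (1:ℝ) ≤ j := by exact_mod_cast hj.1
          have hk0 : (1:ℝ) ≤ k := by exact_mod_cast hk.1
          have hj1 : (j:ℝ) ≤ N := by exact_mod_cast hj.2
          have hk1 : (k:ℝ) ≤ N := by exact_mod_cast hk.2
          rw [div_le_div_iff₀ hN0 (by positivity), one_mul]
          rcases le_total (j:ℝ) k with h | h
          · rw [min_eq_left h]; nlinarith
          · rw [min_eq_right h]; nlinarith
  -- Gaussianity of linear combinations
  have hgauss : ∀ (ι : Type) [Fintype ι] (r : ι → ℕ) (_ : ∀ i, r i ≤ N) (a : ι → ℝ),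
      (ℙ : Measure Ω).map (fun ω => ∑ i, a i * Z (r i) ω) =
        gaussianReal 0 (∑ i, ∑ j, a i * a j * ∫ ω, Z (r i) ω * Z (r j) ω ∂ℙ).toNNReal := by
    intro ι _ r hr a
    have h1 : ∃ (m : ℝ) (v : NNReal), (ℙ : Measure Ω).map (fun ω => ∑ i, a i * Z (r i) ω) =
        gaussianReal m v := by
      obtain ⟨m, v, h⟩ := hG N (fun k => ((k.1 + 1 : ℕ) : ℝ))
        (fun k => ∑ i, if k.1 + 1 ≤ r i then a i / ((k.1 + 1 : ℕ) : ℝ) else 0)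
      refine ⟨m, v, ?_⟩
      rw [← h]
      congr 1
      ext ω
      simp_rw [Finset.sum_mul]
      rw [Finset.sum_comm]
      refine Finset.sum_congr rfl fun i _ => ?_
      rw [hZ, Fin.sum_univ_eq_sum_range (fun k => (if k + 1 ≤ r i then a i / ((k + 1 : ℕ) : ℝ) else 0)
        * B ((k + 1 : ℕ) : ℝ) ω) N, Finset.range_eq_Ico,
        Finset.sum_Ico_add' (fun k => (if k ≤ r i then a i / (k : ℝ) else 0) * B (k : ℝ) ω) 0 N 1,
        Finset.mul_sum]
      have hsub : Finset.Icc 1 (r i) ⊆ Finset.Ico (0 + 1) (N + 1) := by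
        intro k hk
        rw [Finset.mem_Icc] at hk
        have := hr i
        rw [Finset.mem_Ico]; omega
      rw [← Finset.sum_subset hsub]
      · refine Finset.sum_congr rfl fun k hk => ?_
        rw [if_pos (Finset.mem_Icc.1 hk).2]; ring
      · intro k hk hk'
        rw [Finset.mem_Ico] at hk
        rw [Finset.mem_Icc] at hk'
        rw [if_neg (by omega), zero_mul]
    have h2 : ∫ ω, ∑ i, a i * Z (r i) ω ∂ℙ = 0 := by
      rw [integral_finsetSum _ (fun k _ => ((hZL _).integrable (by norm_num)).const_mul _)]
      apply Finset.sum_eq_zero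
      intro k _
      rw [integral_const_mul, hZmean, mul_zero]
    rw [law_of_centered _ _ (by fun_prop) h1 h2]
    congr 2
    simp_rw [pow_two, Finset.sum_mul_sum]
    have hi : ∀ i j, Integrable (fun ω => a i * Z (r i) ω * (a j * Z (r j) ω)) ℙ := by
      intro i j
      have := ((hZL (r i)).integrable_mul (hZL (r j))).const_mul (a i * a j)
      refine this.congr (ae_of_all _ fun ω => ?_)
      simp only [Pi.mul_apply]
      ring
    rw [integral_finsetSum _ (fun j _ => integrable_finsetSum _ fun k _ => hi j k)]
    refine Finset.sum_congr rfl fun j _ => ?_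
    rw [integral_finsetSum _ (fun k _ => hi j k)]
    refine Finset.sum_congr rfl fun k _ => ?_
    have e : ∀ ω, a j * Z (r j) ω * (a k * Z (r k) ω) = a j * a k * (Z (r j) ω * Z (r k) ω) := by
      intro ω; ring
    simp_rw [e]
    rw [integral_const_mul]
  have hN1 : (1:ℝ) ≤ N := by exact_mod_cast hN
  have hx0 : 0 < (N:ℝ) ^ α := by positivity
  have hcorr' : ∀ m n, corr (Z m) (Z n) ℙ = (∫ ω, Z m ω * Z n ω ∂ℙ) /
      (√(∫ ω, Z m ω ^ 2 ∂ℙ) * √(∫ ω, Z n ω ^ 2 ∂ℙ)) := by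
    intro m n
    rw [corr, cov, hZmean, zero_mul, sub_zero]
  rcases Nat.lt_or_ge M 2 with hM | hM
  · -- at most one point: use time `N`
    have hlaw := hgauss (Fin 1) (fun _ => N) (fun _ => le_rfl) (fun _ => 1)
    simp only [Finset.univ_unique, Finset.sum_singleton, one_mul, ← pow_two, one_pow] at hlaw
    set V := ∫ ω, Z N ω ^ 2 ∂ℙ with hV
    have hV0 : 0 < V := by linarith
    have hxV : (N:ℝ) ^ α ≤ √V := by
      refine le_trans ?_ (Real.sqrt_le_sqrt hVN)
      rw [Real.sqrt_eq_rpow]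
      exact Real.rpow_le_rpow_of_exponent_le hN1 hα.2.le
    have h1 : ℙ {ω | ∀ k ≤ N, Z k ω ≤ (N : ℝ) ^ α} ≤ ℙ (Z N ⁻¹' Set.Iic ((N:ℝ) ^ α)) :=
      measure_mono fun ω hω => hω N le_rfl
    refine h1.trans ?_
    rw [← Measure.map_apply (hZm N) measurableSet_Iic, hlaw]
    refine (gauss_pos _ (by simpa using hV0) _ hx0.le).trans (ENNReal.ofReal_le_ofReal ?_)
    rw [Real.coe_toNNReal _ hV0.le, Real.sqrt_mul (by positivity)]
    have h2 : (N:ℝ) ^ α / (√(2 * π) * √V) ≤ 1 / √(2 * π) := by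
      rw [div_le_div_iff₀ (by positivity) (by positivity)]
      nlinarith [Real.sqrt_pos.2 (show (0:ℝ) < 2 * π by positivity)]
    have h3 : (2.5 : ℝ) ≤ √(2 * π) := by
      apply Real.le_sqrt_of_sq_le
      nlinarith [Real.pi_gt_d4]
    have h4 : 1 / √(2 * π) ≤ 1 / 2.5 := by gcongr
    have h5 := Real.add_one_le_exp (-(M:ℝ)/10)
    have h6 : (M:ℝ) ≤ 1 := by exact_mod_cast (by omega : M ≤ 1)
    linarith
  · -- at least two points: drop the earliest one
    obtain ⟨i0, -, hi0⟩ := Finset.exists_min_image (Finset.univ : Finset (Fin M)) s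
      ⟨⟨0, by omega⟩, Finset.mem_univ _⟩
    set σ : Fin M → ℝ := fun i => √(∫ ω, Z (s i) ω ^ 2 ∂ℙ) with hσ
    have hσ0 : ∀ i, 0 < σ i := fun i => lt_of_lt_of_le (by positivity) (hsd i)
    have hσ2 : ∀ i, σ i * σ i = ∫ ω, Z (s i) ω ^ 2 ∂ℙ := fun i =>
      Real.mul_self_sqrt (integral_nonneg fun ω => sq_nonneg _)
    have hdiag : ∀ i, corr (Z (s i)) (Z (s i)) ℙ = 1 := by
      intro i
      rw [hcorr']
      have e : ∫ ω, Z (s i) ω * Z (s i) ω ∂ℙ = σ i * σ i := by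
        rw [hσ2 i]; simp_rw [pow_two]
      rw [e]
      exact div_self (mul_pos (hσ0 i) (hσ0 i)).ne'
    have hbig : ∀ i, i ≠ i0 → (N:ℝ) ^ α / σ i ≤ 1/2 := by
      intro i hi
      have h1 : |corr (Z (s i)) (Z (s i)) ℙ| + |corr (Z (s i)) (Z (s i0)) ℙ| ≤ 5/4 := by
        refine le_trans ?_ (hcorr i)
        rw [← Finset.sum_pair (f := fun j => |corr (Z (s i)) (Z (s j)) ℙ|) hi]
        exact Finset.sum_le_sum_of_subset_of_nonneg (Finset.subset_univ _) fun _ _ _ => abs_nonneg _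
      rw [hdiag, abs_one] at h1
      have h2 : σ i0 / σ i ≤ corr (Z (s i)) (Z (s i0)) ℙ := by
        rw [hcorr']
        change _ ≤ _ / (σ i * σ i0)
        rw [div_le_div_iff₀ (hσ0 i) (mul_pos (hσ0 i) (hσ0 i0))]
        have := hZmono (s i0) (s i) (hi0 i (Finset.mem_univ _))
        rw [← hσ2 i0] at this
        simp_rw [mul_comm (Z (s i0) _)] at this
        nlinarith [hσ0 i]
      have h3 : σ i0 / σ i ≤ 1/4 := by linarith [le_abs_self (corr (Z (s i)) (Z (s i0)) ℙ)]
      rw [div_le_iff₀ (hσ0 i)] at h3 ⊢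
      have := hsd i0
      change _ ≤ σ i0 at this
      linarith
    have key := core (ℙ : Measure Ω) (ι := {i : Fin M // i ≠ i0})
      (fun i ω => Z (s i) ω / σ i) (fun i => (hZm _).div_const _)
      (Matrix.of fun i j => corr (Z (s i)) (Z (s j)) ℙ)
      (fun i j => by
        simp only [Matrix.of_apply, hcorr']
        simp_rw [mul_comm])
      (fun i => hdiag i)
      (fun i => by
        refine le_trans ?_ (hcorr i)
        simp only [Matrix.of_apply]
        rw [← Finset.sum_subtype (Finset.univ.erase i0) (by simp)
          (fun j => |corr (Z (s i)) (Z (s j)) ℙ|)]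
        exact Finset.sum_le_sum_of_subset_of_nonneg (Finset.subset_univ _) fun _ _ _ => abs_nonneg _)
      (fun x => by
        have := hgauss {i : Fin M // i ≠ i0} (fun i => s i) (fun i => hs i) (fun i => x i / σ i)
        convert this using 3
        · refine Finset.sum_congr rfl fun i _ => ?_
          ring
        · refine Finset.sum_congr rfl fun i _ => Finset.sum_congr rfl fun j _ => ?_
          rw [Matrix.of_apply, hcorr']
          change x i * (_ / (σ i * σ j) * x j) = _
          have := hσ0 i
          have := hσ0 j
          field_simp)
    refine le_trans (measure_mono ?_) (key.trans ?_)
    · intro ω hω i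
      have h1 : Z (s i) ω ≤ (N:ℝ) ^ α := hω _ (hs i)
      exact (div_le_div_of_nonneg_right h1 (hσ0 i).le).trans (hbig i i.2)
    · rw [← ENNReal.ofReal_pow (by positivity), ← Real.exp_nat_mul]
      apply ENNReal.ofReal_le_ofReal
      apply Real.exp_le_exp.2
      have : Fintype.card {i : Fin M // i ≠ i0} = M - 1 := by simp
      rw [this, Nat.cast_sub (by omega)]
      have : (2:ℝ) ≤ M := by exact_mod_cast hM
      push_cast
      linarith
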